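/- arXiv:1710.04107 — 2 statements merged into one kernel-verified Lean document; each statement's English description precedes it below -/
import Mathlib

section
/- Let C = Av(312,213) and let π, τ ∈ C be nonempty. Then Av_C(π) and Av_C(τ) are Wilf-equivalent (i.e. for every n the number of permutations of size n in C avoiding π equals the number of permutations of size n in C avoiding τ) if and only if |π| = |τ|. -/
/-- `l` is the one-line notation of a permutation of `{1, …, l.length}`. -/
def IsPermList (l : List ℕ) : Prop :=
  l.Perm ((List.range l.length).map (· + 1))

/-- `Involves σ τ` means the permutation (in one-line notation) `σ` is involved in `τ`
(written σ ≼ τ): there is a strictly increasing map of positions matching relative order. -/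
def Involves (σ τ : List ℕ) : Prop :=
  ∃ f : Fin σ.length → Fin τ.length, StrictMono f ∧
    ∀ i j : Fin σ.length, σ.get i < σ.get j ↔ τ.get (f i) < τ.get (f j)

/-- Direct sum `σ ⊕ τ` of permutations in one-line notation. -/
def dsum (σ τ : List ℕ) : List ℕ := σ ++ τ.map (· + σ.length)

/-- The unimodal list on the values `s, …, s + w.length` in which the `i`-th smallest value lies to
the left of all larger ones if `w[i]` is `true`, and to the right of them if it is `false`. -/
def unimodal : ℕ → List Bool → List ℕ
  | s, [] => [s]
  | s, true :: w => s :: unimodal (s + 1) w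
  | s, false :: w => unimodal (s + 1) w ++ [s]

theorem unimodal_perm (s : ℕ) (w : List Bool) :
    (unimodal s w).Perm (List.range' s (w.length + 1)) := by
  induction w generalizing s with
  | nil => simp [unimodal]
  | cons b w ih =>
    rw [List.length_cons, List.range'_succ]
    cases b
    · exact List.perm_append_comm.trans ((ih _).cons s)
    · exact (ih _).cons s

theorem length_unimodal (s : ℕ) (w : List Bool) : (unimodal s w).length = w.length + 1 := by
  simpa using (unimodal_perm s w).length_eq

theorem le_of_mem_unimodal {s a : ℕ} {w : List Bool} (h : a ∈ unimodal s w) : s ≤ a := by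
  have := (unimodal_perm s w).mem_iff.1 h
  simp only [List.mem_range'_1] at this
  exact this.1

theorem unimodal_ne_nil (s : ℕ) (w : List Bool) : unimodal s w ≠ [] := by
  intro h
  simpa [h] using length_unimodal s w

theorem isPermList_iff {l : List ℕ} : IsPermList l ↔ l.Perm (List.range' 1 l.length) := by
  rw [IsPermList, List.range'_eq_map_range]
  simp only [Nat.add_comm]

theorem IsPermList.nodup {l : List ℕ} (h : IsPermList l) : l.Nodup :=
  (isPermList_iff.1 h).nodup_iff.2 List.nodup_range'

/-- Involvement of lists as the existence of a relabelling of the values. -/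
theorem involves_iff_exists_map_sublist {σ τ : List ℕ} :
    Involves σ τ ↔ ∃ g : ℕ → ℕ, StrictMonoOn g {a | a ∈ σ} ∧ (σ.map g).Sublist τ := by
  constructor
  · rintro ⟨f, hf, h⟩
    have hex : ∀ a : ℕ, ∃ b : ℕ, ∀ i : Fin σ.length, σ.get i = a → τ.get (f i) = b := by
      intro a
      by_cases ha : ∃ i : Fin σ.length, σ.get i = a
      · obtain ⟨i, hi⟩ := ha
        refine ⟨τ.get (f i), fun j hj => ?_⟩
        have h1 := h i j
        have h2 := h j i
        rw [hi, hj] at h1 h2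
        simp only [lt_irrefl, false_iff, not_lt] at h1 h2
        exact le_antisymm h1 h2
      · exact ⟨0, fun i hi => absurd ⟨i, hi⟩ ha⟩
    choose g hg using hex
    refine ⟨g, ?_, ?_⟩
    · intro a ha b hb hab
      obtain ⟨i, rfl⟩ := List.mem_iff_get.1 ha
      obtain ⟨j, rfl⟩ := List.mem_iff_get.1 hb
      rw [← hg _ i rfl, ← hg _ j rfl]
      exact (h i j).1 hab
    · rw [List.sublist_iff_exists_fin_orderEmbedding_get_eq]
      let c : Fin (σ.map g).length ≃o Fin σ.length := Fin.castOrderIso (List.length_map g)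
      refine ⟨c.toOrderEmbedding.trans (OrderEmbedding.ofStrictMono f hf), fun i => ?_⟩
      simpa [c] using (hg _ (c i) rfl).symm
  · rintro ⟨g, hg, hs⟩
    obtain ⟨e, he⟩ := List.sublist_iff_exists_fin_orderEmbedding_get_eq.1 hs
    let c : Fin σ.length ≃o Fin (σ.map g).length := Fin.castOrderIso (List.length_map g).symm
    refine ⟨fun i => e (c i), fun i j hij => e.strictMono (c.strictMono hij), fun i j => ?_⟩
    rw [← he, ← he]
    simpa [c] using (hg.lt_iff_lt (List.get_mem σ i) (List.get_mem σ j)).symm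

theorem Involves.refl (σ : List ℕ) : Involves σ σ :=
  ⟨id, strictMono_id, fun _ _ => Iff.rfl⟩

theorem not_involves_nil {σ : List ℕ} (h : σ ≠ []) : ¬ Involves σ [] := by
  rw [involves_iff_exists_map_sublist]
  rintro ⟨g, -, hs⟩
  simp [h] at hs

theorem sublist_concat_iff {α : Type*} {a : α} {l m : List α} :
    l.Sublist (m ++ [a]) ↔ l.Sublist m ∨ ∃ r, l = r ++ [a] ∧ r.Sublist m := by
  rw [← List.reverse_sublist, List.reverse_append, List.reverse_singleton, List.singleton_append,
    List.sublist_cons_iff, List.reverse_sublist]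
  refine or_congr_right ⟨?_, ?_⟩
  · rintro ⟨r, hr, hm⟩
    exact ⟨r.reverse, by rw [← List.reverse_reverse l, hr, List.reverse_cons],
      by rwa [← List.reverse_sublist, List.reverse_reverse]⟩
  · rintro ⟨r, rfl, hm⟩
    exact ⟨r.reverse, by simp, hm.reverse⟩

theorem sublist_of_map_unimodal_sublist {s t : ℕ} {u v : List Bool} {g : ℕ → ℕ}
    (hg : StrictMonoOn g {a | a ∈ unimodal s u})
    (h : ((unimodal s u).map g).Sublist (unimodal t v)) : u.Sublist v := by
  induction v generalizing s t u with
  | nil =>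
    have := h.length_le
    simp only [List.length_map, length_unimodal, List.length_nil] at this
    rw [List.length_eq_zero_iff.1 (by omega : u.length = 0)]
  | cons b v ih =>
    obtain _ | ⟨c, u⟩ := u
    · exact List.nil_sublist _
    have hlt : ∀ x ∈ unimodal (s + 1) u, t < g x := by
      intro x hx
      have hs : s ∈ unimodal s (c :: u) := by cases c <;> simp [unimodal]
      have hx' : x ∈ unimodal s (c :: u) := by cases c <;> simp [unimodal, hx]
      have h1 : t ≤ g s := le_of_mem_unimodal (h.subset (List.mem_map_of_mem hs))
      exact h1.trans_lt (hg hs hx' (le_of_mem_unimodal hx))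
    have hg' : StrictMonoOn g {a | a ∈ unimodal (s + 1) u} :=
      hg.mono fun a ha => by cases c <;> simp_all [unimodal]
    cases b <;> cases c <;>
      simp only [unimodal, List.map_cons, List.map_append, List.map_nil] at h hg
    · refine (ih (t := t + 1) hg' ?_).cons_cons _
      simpa using h.reverse.tail.reverse
    · refine (ih (u := true :: u) hg (?_ : List.Sublist _ (unimodal (t + 1) v))).cons _
      obtain h | ⟨r, hr, -⟩ := sublist_concat_iff.1 h
      · simpa [unimodal] using h
      · obtain ⟨l, x, hx⟩ :=
          (List.eq_nil_or_concat' _).resolve_left (unimodal_ne_nil (s + 1) u)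
        have := hlt x (by simp [hx])
        have hlast := congrArg List.getLast? hr
        simp only [hx, List.map_append, List.map_cons, List.map_nil, ← List.cons_append,
          List.getLast?_concat, Option.some.injEq] at hlast
        omega
    · refine (ih (u := false :: u) hg (?_ : List.Sublist _ (unimodal (t + 1) v))).cons _
      obtain h | ⟨r, hr, -⟩ := List.sublist_cons_iff.1 h
      · simpa [unimodal] using h
      · obtain ⟨x, l, hx⟩ := List.exists_cons_of_ne_nil (unimodal_ne_nil (s + 1) u)
        have := hlt x (by simp [hx])
        simp only [hx, List.map_cons, List.cons_append, List.cons.injEq] at hr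
        omega
    · exact (ih hg' (by simpa using h.tail)).cons_cons _

theorem involves_unimodal_of_sublist {u v : List Bool} (h : u.Sublist v) (s t : ℕ) :
    Involves (unimodal s u) (unimodal t v) := by
  rw [involves_iff_exists_map_sublist]
  induction h generalizing s t with
  | slnil => exact ⟨fun _ => t, by simp [unimodal, StrictMonoOn]⟩
  | @cons u v b h ih =>
    obtain ⟨g, hg, hs⟩ := ih s (t + 1)
    refine ⟨g, hg, hs.trans ?_⟩
    cases b <;> simp [unimodal]
  | @cons_cons u v b h ih =>
    obtain ⟨g, hg, hs⟩ := ih (s + 1) (t + 1)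
    have hmap : (unimodal (s + 1) u).map (fun a => if a = s then t else g a) =
        (unimodal (s + 1) u).map g := by
      refine List.map_congr_left fun a ha => if_neg ?_
      have := le_of_mem_unimodal ha
      omega
    have hlt : ∀ x ∈ unimodal (s + 1) u, s < x ∧ t < g x := fun x hx =>
      ⟨le_of_mem_unimodal hx, le_of_mem_unimodal (hs.subset (List.mem_map_of_mem hx))⟩
    refine ⟨fun a => if a = s then t else g a, ?_, ?_⟩
    · have hmem : ∀ x ∈ unimodal s (b :: u), x = s ∨ x ∈ unimodal (s + 1) u := by
        cases b <;> simp [unimodal, or_comm]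
      intro x hx y hy hxy
      have hx' := hmem x hx
      have hy' := hmem y hy
      dsimp only
      rcases hx' with rfl | hx' <;> rcases hy' with rfl | hy'
      · omega
      · rw [if_pos rfl, if_neg hxy.ne']
        exact (hlt y hy').2
      · have := (hlt x hx').1
        omega
      · rw [if_neg (hlt x hx').1.ne', if_neg (hlt y hy').1.ne']
        exact hg hx' hy' hxy
    · cases b
      · simp only [unimodal, List.map_append, hmap]
        simpa using hs
      · simp only [unimodal, List.map_cons, hmap]
        simpa using hs

theorem involves_unimodal_iff {s t : ℕ} {u v : List Bool} :
    Involves (unimodal s u) (unimodal t v) ↔ u.Sublist v := by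
  refine ⟨fun h => ?_, fun h => involves_unimodal_of_sublist h s t⟩
  obtain ⟨g, hg, hs⟩ := involves_iff_exists_map_sublist.1 h
  exact sublist_of_map_unimodal_sublist hg hs

theorem unimodal_injective (s : ℕ) : Function.Injective (unimodal s) := by
  intro u v h
  have huv := Involves.refl (unimodal s u)
  have hvu := huv
  rw [h] at hvu
  nth_rw 2 [h] at huv
  nth_rw 2 [← h] at hvu
  exact (involves_unimodal_iff.1 huv).antisymm (involves_unimodal_iff.1 hvu)

/-- A list has a valley if some entry is smaller than an earlier and than a later entry. -/
def HasValley (l : List ℕ) : Prop :=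
  ∃ a b c, [a, b, c].Sublist l ∧ b < a ∧ b < c

theorem not_hasValley_unimodal (s : ℕ) (w : List Bool) : ¬ HasValley (unimodal s w) := by
  rintro ⟨a, b, c, h, hba, hbc⟩
  induction w generalizing s with
  | nil => simpa [unimodal] using h.length_le
  | cons d w ih =>
    have hb : s ≤ b := le_of_mem_unimodal (h.subset (by simp))
    cases d
    · obtain h | ⟨r, hr, -⟩ := sublist_concat_iff.1 h
      · exact ih _ h
      · have := congrArg List.getLast? hr
        simp at this
        omega
    · obtain h | ⟨r, hr, -⟩ := List.sublist_cons_iff.1 h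
      · exact ih _ h
      · simp only [List.cons.injEq] at hr
        omega

theorem exists_eq_unimodal {l : List ℕ} {s n : ℕ} (hl : l.Perm (List.range' s (n + 1)))
    (hv : ¬ HasValley l) : ∃ w, l = unimodal s w := by
  induction n generalizing s l with
  | zero => exact ⟨[], by simpa [unimodal] using hl⟩
  | succ n ih =>
    rw [List.range'_succ] at hl
    obtain ⟨p, q, rfl⟩ := List.append_of_mem (hl.mem_iff.2 List.mem_cons_self)
    have hpq : (p ++ q).Perm (List.range' (s + 1) (n + 1)) :=
      (List.perm_middle.symm.trans hl).cons_inv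
    have hlt : ∀ x ∈ p ++ q, s < x := fun x hx =>
      (List.mem_range'_1.1 (hpq.mem_iff.1 hx)).1
    obtain _ | ⟨a, p⟩ := p
    · obtain ⟨w, rfl⟩ := ih (l := q) hpq fun ⟨a, b, c, h, h'⟩ => hv ⟨a, b, c, h.cons _, h'⟩
      exact ⟨true :: w, rfl⟩
    obtain _ | ⟨c, q⟩ := q
    · obtain ⟨w, hw⟩ := ih (l := a :: p) (by simpa using hpq) fun ⟨x, b, c, h, h'⟩ =>
        hv ⟨x, b, c, h.trans (List.sublist_append_left _ _), h'⟩
      exact ⟨false :: w, by rw [hw, unimodal]⟩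
    · refine absurd ⟨a, s, c, ?_, hlt a (by simp), hlt c (by simp)⟩ hv
      refine List.Sublist.cons_cons a (List.Sublist.trans ?_ (List.sublist_append_right p _))
      simp

theorem hasValley_of_involves {x y z : ℕ} {l : List ℕ} (hyx : y < x) (hyz : y < z)
    (h : Involves [x, y, z] l) : HasValley l := by
  obtain ⟨g, hg, hs⟩ := involves_iff_exists_map_sublist.1 h
  exact ⟨g x, g y, g z, hs, hg (by simp) (by simp) hyx, hg (by simp) (by simp) hyz⟩

theorem hasValley_iff {l : List ℕ} (hl : l.Nodup) :
    HasValley l ↔ Involves [3, 1, 2] l ∨ Involves [2, 1, 3] l := by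
  constructor
  · rintro ⟨a, b, c, h, hba, hbc⟩
    have hac : a ≠ c := by
      have := h.nodup hl
      simp at this
      tauto
    simp only [involves_iff_exists_map_sublist]
    obtain hac | hac := hac.lt_or_gt
    · refine Or.inr ⟨fun x => if x = 1 then b else if x = 2 then a else c, ?_, by simpa using h⟩
      simp [StrictMonoOn]
      omega
    · refine Or.inl ⟨fun x => if x = 1 then b else if x = 2 then c else a, ?_, by simpa using h⟩
      simp [StrictMonoOn]
      omega
  · rintro (h | h) <;> exact hasValley_of_involves (by norm_num) (by norm_num) h

theorem isPermList_unimodal (w : List Bool) : IsPermList (unimodal 1 w) := by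
  rw [isPermList_iff, length_unimodal]
  exact unimodal_perm 1 w

theorem not_involves_unimodal (w : List Bool) :
    ¬ Involves [3, 1, 2] (unimodal 1 w) ∧ ¬ Involves [2, 1, 3] (unimodal 1 w) := by
  rw [← not_or, ← hasValley_iff (isPermList_unimodal w).nodup]
  exact not_hasValley_unimodal 1 w

theorem exists_eq_unimodal_of_isPermList {l : List ℕ} (hl : IsPermList l) (hne : l ≠ [])
    (hC : ¬ Involves [3, 1, 2] l ∧ ¬ Involves [2, 1, 3] l) : ∃ w, l = unimodal 1 w := by
  rw [← not_or, ← hasValley_iff hl.nodup] at hC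
  obtain ⟨n, hn⟩ := Nat.exists_eq_succ_of_ne_zero (mt List.length_eq_zero_iff.1 hne)
  exact exists_eq_unimodal (n := n) (by simpa [hn] using isPermList_iff.1 hl) hC

theorem card_avoiders_eq (u : List Bool) (n : ℕ) :
    Nat.card {l : List ℕ // l.length = n + 1 ∧ IsPermList l ∧
      ¬ Involves [3, 1, 2] l ∧ ¬ Involves [2, 1, 3] l ∧ ¬ Involves (unimodal 1 u) l} =
    Nat.card {w : List Bool // w.length = n ∧ ¬ u.Sublist w} := by
  symm
  refine Nat.card_congr (Equiv.ofBijective (fun w => ⟨unimodal 1 w.1, ?mem⟩) ⟨?inj, ?surj⟩)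
  case mem =>
    obtain ⟨w, hw, hu⟩ := w
    exact ⟨by rw [length_unimodal, hw], isPermList_unimodal w, (not_involves_unimodal w).1,
      (not_involves_unimodal w).2, by rwa [involves_unimodal_iff]⟩
  case inj =>
    intro w w' h
    exact Subtype.ext (unimodal_injective 1 (congrArg Subtype.val h))
  case surj =>
    rintro ⟨l, hl, hp, h₁, h₂, hu⟩
    obtain ⟨w, rfl⟩ := exists_eq_unimodal_of_isPermList hp (by rintro rfl; simp at hl) ⟨h₁, h₂⟩
    rw [length_unimodal] at hl
    rw [involves_unimodal_iff] at hu
    exact ⟨⟨w, by omega, hu⟩, rfl⟩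

/-- Transport of binary words along the greedy embeddings of `u` and `v`: the letters used in the
leftmost embedding of `u` are replaced by those of `v`. -/
def transport : List Bool → List Bool → List Bool → List Bool
  | c :: u, d :: v, b :: w =>
    if b = c then d :: transport u v w else (!d) :: transport (c :: u) (d :: v) w
  | _, _, w => w

theorem length_transport (u v w : List Bool) : (transport u v w).length = w.length := by
  fun_induction transport u v w <;> simp_all

theorem transport_transport (u v w : List Bool) : transport v u (transport u v w) = w := by
  fun_induction transport u v w with
  | case1 => simp_all [transport]
  | case2 c u d v b w h ih =>
    rw [transport, if_neg (by simp), ih, Bool.eq_not.2 (Ne.symm h)]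
    simp
  | case3 u v w h =>
    obtain _ | ⟨c, u⟩ := u <;> obtain _ | ⟨d, v⟩ := v <;> obtain _ | ⟨b, w⟩ := w <;>
      first | exact (h _ _ _ _ _ _ rfl rfl rfl).elim | simp [transport]

theorem sublist_transport_iff {u v : List Bool} (h : u.length = v.length) (w : List Bool) :
    v.Sublist (transport u v w) ↔ u.Sublist w := by
  fun_induction transport u v w with
  | case1 => simp_all
  | case2 c u d v b w hb ih =>
    have hc : ¬ c = b := Ne.symm hb
    simpa [List.sublist_cons_iff (a := !d), List.sublist_cons_iff (a := b), hc] using ih h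
  | case3 u v w hcons =>
    obtain _ | ⟨c, u⟩ := u <;> obtain _ | ⟨d, v⟩ := v <;> obtain _ | ⟨b, w⟩ := w <;>
      first | exact (hcons _ _ _ _ _ _ rfl rfl rfl).elim | simp_all

theorem card_words_eq {u v : List Bool} (h : u.length = v.length) (n : ℕ) :
    Nat.card {w : List Bool // w.length = n ∧ ¬ u.Sublist w} =
      Nat.card {w : List Bool // w.length = n ∧ ¬ v.Sublist w} :=
  Nat.card_congr
    { toFun := fun w => ⟨transport u v w.1, by
        rw [length_transport, sublist_transport_iff h]; exact w.2⟩
      invFun := fun w => ⟨transport v u w.1, by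
        rw [length_transport, sublist_transport_iff h.symm]; exact w.2⟩
      left_inv := fun w => Subtype.ext (transport_transport u v w.1)
      right_inv := fun w => Subtype.ext (transport_transport v u w.1) }

theorem card_words_lt {u v : List Bool} (h : u.length < v.length) :
    Nat.card {w : List Bool // w.length = u.length ∧ ¬ u.Sublist w} <
      Nat.card {w : List Bool // w.length = u.length ∧ ¬ v.Sublist w} := by
  refine Set.ncard_lt_ncard (s := {w | w.length = u.length ∧ ¬ u.Sublist w})
    (t := {w | w.length = u.length ∧ ¬ v.Sublist w})
    ⟨fun w hw => ⟨hw.1, fun hv => ?_⟩, fun hsub => ?_⟩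
    ((List.finite_length_eq Bool u.length).subset fun w hw => hw.1)
  · have := hv.length_le
    have := hw.1
    omega
  · exact (hsub ⟨rfl, fun hv => by have := hv.length_le; omega⟩).2 (List.Sublist.refl u)

/-- In `C = Av(312, 213)`, two nonempty `π, τ ∈ C` give Wilf-equivalent principal subclasses
iff they have the same size. -/
theorem wilf_av312_213 (π τ : List ℕ) (hπ : IsPermList π) (hτ : IsPermList τ)
    (hπne : π ≠ []) (hτne : τ ≠ [])
    (hπC : ¬ Involves [3, 1, 2] π ∧ ¬ Involves [2, 1, 3] π)
    (hτC : ¬ Involves [3, 1, 2] τ ∧ ¬ Involves [2, 1, 3] τ) :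
    (∀ n : ℕ,
        Nat.card {l : List ℕ // l.length = n ∧ IsPermList l ∧
          ¬ Involves [3, 1, 2] l ∧ ¬ Involves [2, 1, 3] l ∧ ¬ Involves π l} =
        Nat.card {l : List ℕ // l.length = n ∧ IsPermList l ∧
          ¬ Involves [3, 1, 2] l ∧ ¬ Involves [2, 1, 3] l ∧ ¬ Involves τ l}) ↔
      π.length = τ.length := by
  obtain ⟨u, rfl⟩ := exists_eq_unimodal_of_isPermList hπ hπne hπC
  obtain ⟨v, rfl⟩ := exists_eq_unimodal_of_isPermList hτ hτne hτC
  rw [length_unimodal, length_unimodal, Nat.add_right_cancel_iff]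
  constructor
  · intro h
    have hcard : ∀ n, Nat.card {w : List Bool // w.length = n ∧ ¬ u.Sublist w} =
        Nat.card {w : List Bool // w.length = n ∧ ¬ v.Sublist w} := fun n => by
      rw [← card_avoiders_eq, ← card_avoiders_eq, h]
    obtain hlt | heq | hgt := lt_trichotomy u.length v.length
    · exact absurd (hcard _) (card_words_lt hlt).ne
    · exact heq
    · exact absurd (hcard _) (card_words_lt hgt).ne'
  · rintro h (_ | n)
    · refine Nat.card_congr (Equiv.subtypeEquivRight fun l => and_congr_right fun hl => ?_)
      rw [List.length_eq_zero_iff] at hl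
      subst hl
      simp only [not_involves_nil (unimodal_ne_nil _ _)]
    · rw [card_avoiders_eq, card_avoiders_eq, card_words_eq h]
end

section
/- Let k ≥ 2 and let β_k denote the permutation 2 3 ⋯ k 1 of size k. Then for every n, the number of permutations of size n avoiding all of 312, 321, and 21 ⊕ β_k equals the number of permutations of size n avoiding all of 312, 321, and 1 ⊕ β_k ⊕ 1. -/
/-- `β_k = 2 3 ⋯ k 1`, in one-line notation. -/
def beta (k : ℕ) : List ℕ := (List.range (k - 1)).map (· + 2) ++ [1]

/-- The zero-based one-line notation of `β_{a₁} ⊕ β_{a₂} ⊕ ⋯`, as a function on positions,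
extended by the identity. -/
def blockFun : List ℕ → ℕ → ℕ
  | [], p => p
  | a :: c, p => if p + 1 < a then p + 1 else if p < a then 0 else a + blockFun c (p - a)

/-- The one-line notation of `β_{a₁} ⊕ β_{a₂} ⊕ ⋯`. -/
def blockPerm (c : List ℕ) : List ℕ := (List.range c.sum).map (blockFun c · + 1)

theorem blockFun_cons_add (a : ℕ) (c : List ℕ) (p : ℕ) :
    blockFun (a :: c) (a + p) = a + blockFun c p := by
  simp [blockFun, show ¬ a + p + 1 < a by omega]

theorem blockFun_lt {c : List ℕ} : ∀ {p : ℕ}, p < c.sum → blockFun c p < c.sum := by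
  induction c with
  | nil => simp
  | cons a c ih =>
    intro p hp
    simp only [List.sum_cons, blockFun] at hp ⊢
    have := @ih (p - a)
    split_ifs <;> omega

theorem blockFun_inj {c : List ℕ} :
    ∀ {p q : ℕ}, blockFun c p = blockFun c q → p = q := by
  induction c with
  | nil => simp [blockFun]
  | cons a c ih =>
    intro p q h
    simp only [blockFun] at h
    have := @ih (p - a) (q - a)
    split_ifs at h <;> omega

theorem exists_blockFun_eq {c : List ℕ} :
    ∀ {v : ℕ}, v < c.sum → ∃ p < c.sum, blockFun c p = v := by
  induction c with
  | nil => simp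
  | cons a c ih =>
    intro v hv
    simp only [List.sum_cons] at hv ⊢
    by_cases hva : v < a
    · by_cases h0 : v = 0
      · exact ⟨a - 1, by omega, by simp only [blockFun]; split_ifs <;> omega⟩
      · exact ⟨v - 1, by omega, by simp only [blockFun]; split_ifs <;> omega⟩
    · obtain ⟨p, hp, h⟩ := @ih (v - a) (by omega)
      exact ⟨a + p, by omega, by rw [blockFun_cons_add]; omega⟩

/-- No entry of `f` on `[0, n)` has two smaller entries to its right, that is, `f` avoids
312 and 321. -/
def AtMostOneSmaller (f : ℕ → ℕ) (n : ℕ) : Prop :=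
  ∀ i j m, i < j → j < m → m < n → f j < f i → f i ≤ f m

theorem atMostOneSmaller_blockFun (c : List ℕ) : AtMostOneSmaller (blockFun c) c.sum := by
  induction c with
  | nil => simp [AtMostOneSmaller]
  | cons a c ih =>
    intro i j m hij hjm hm h
    simp only [List.sum_cons] at hm
    have := ih (i - a) (j - a) (m - a)
    simp only [blockFun] at h ⊢
    split_ifs at h ⊢ <;> omega

theorem eq_of_blockFun_eq {c d : List ℕ} (hc : ∀ x ∈ c, 0 < x) (hd : ∀ x ∈ d, 0 < x)
    (hsum : c.sum = d.sum) (h : ∀ p < c.sum, blockFun c p = blockFun d p) : c = d := by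
  induction c generalizing d with
  | nil =>
    cases d with
    | nil => rfl
    | cons b d =>
      have := hd b (by simp)
      simp only [List.sum_cons, List.sum_nil] at hsum
      omega
  | cons a c ih =>
    have ha := hc a (by simp)
    cases d with
    | nil => simp only [List.sum_cons, List.sum_nil] at hsum; omega
    | cons b d =>
      have hb := hd b (by simp)
      simp only [List.sum_cons] at hsum h
      have h1 := h (a - 1) (by omega)
      obtain rfl : a = b := by
        simp only [blockFun] at h1
        split_ifs at h1 <;> omega
      refine congrArg (a :: ·) (ih (fun x hx => hc x (by simp [hx]))
        (fun x hx => hd x (by simp [hx])) (by omega) fun p hp => ?_)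
      have := h (a + p) (by omega)
      rwa [blockFun_cons_add, blockFun_cons_add, Nat.add_left_cancel_iff] at this

theorem exists_blockFun_of_atMostOneSmaller {n : ℕ} : ∀ {f : ℕ → ℕ}, (∀ i < n, f i < n) →
    (∀ i < n, ∀ j < n, f i = f j → i = j) → (∀ v < n, ∃ i < n, f i = v) →
    AtMostOneSmaller f n →
    ∃ c : List ℕ, (∀ x ∈ c, 0 < x) ∧ c.sum = n ∧ ∀ i < n, f i = blockFun c i := by
  induction n with
  | zero => intro f _ _ _ _; exact ⟨[], by simp⟩
  | succ n ih =>
    intro f hlt hinj hsurj havoid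
    have h01 : f 0 ≤ 1 := by
      by_contra hf
      have := hlt 0 (by omega)
      obtain ⟨i, hi, hi0⟩ := hsurj 0 (by omega)
      obtain ⟨j, hj, hj1⟩ := hsurj 1 (by omega)
      have hi' : i ≠ 0 := by rintro rfl; omega
      have hj' : j ≠ 0 := by rintro rfl; omega
      have hij : i ≠ j := by rintro rfl; omega
      have h1 := havoid 0 i j
      have h2 := havoid 0 j i
      omega
    have hpos : ∀ i < n, f (i + 1) ≠ f 0 := fun i hi h => by
      have := hinj _ (by omega) _ (by omega) h
      omega
    obtain h0 | h0 : f 0 = 0 ∨ f 0 = 1 := by omega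
    · obtain ⟨c, hc, hsum, heq⟩ := @ih (fun i => f (i + 1) - 1)
        (fun i hi => by have := hlt (i + 1) (by omega); have := hpos i hi; omega)
        (fun i hi j hj h => by
          have := hpos i hi
          have := hpos j hj
          have := hinj (i + 1) (by omega) (j + 1) (by omega)
          omega)
        (fun v hv => by
          obtain ⟨i, hi, h⟩ := hsurj (v + 1) (by omega)
          obtain _ | i := i
          · omega
          · exact ⟨i, by omega, by omega⟩)
        (fun i j m hij hjm hm h => by
          have := hpos i (by omega)
          have := hpos j (by omega)
          have := hpos m (by omega)
          have := havoid (i + 1) (j + 1) (m + 1)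
          dsimp only at h ⊢
          omega)
      refine ⟨1 :: c, by simpa using hc, by simp [hsum, add_comm], fun i hi => ?_⟩
      obtain _ | i := i
      · simp [blockFun, h0]
      · rw [add_comm i 1, blockFun_cons_add, ← heq i (by omega), add_comm 1 i]
        have := hpos i (by omega)
        omega
    · obtain ⟨c, hc, hsum, heq⟩ := @ih (fun i => f (i + 1) - 1)
        (fun i hi => by have := hlt (i + 1) (by omega); have := hlt 0; omega)
        (fun i hi j hj h => by
          have := hpos i hi
          have := hpos j hj
          have := hinj (i + 1) (by omega) (j + 1) (by omega)
          omega)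
        (fun v hv => by
          obtain ⟨i, hi, h⟩ := hsurj (if v = 0 then 0 else v + 1) (by split_ifs <;> omega)
          obtain _ | i := i
          · split_ifs at h <;> omega
          · exact ⟨i, by omega, by split_ifs at h <;> omega⟩)
        (fun i j m hij hjm hm h => by
          have := hpos i (by omega)
          have := hpos j (by omega)
          have := hpos m (by omega)
          have := havoid (i + 1) (j + 1) (m + 1)
          dsimp only at h ⊢
          omega)
      have hn : n ≠ 0 := by rintro rfl; have := hlt 0; omega
      obtain _ | ⟨a, c⟩ := c
      · simp at hsum; omega
      have ha := hc a (by simp)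
      refine ⟨(a + 1) :: c, fun x hx => ?_, by simp at hsum ⊢; omega, fun i hi => ?_⟩
      · obtain rfl | hx := List.mem_cons.1 hx
        · omega
        · exact hc x (by simp [hx])
      · obtain _ | i := i
        · simp only [blockFun]; split_ifs <;> omega
        · have h1 := heq i (by omega)
          have h2 := hpos i (by omega)
          simp only [blockFun] at h1 ⊢
          rw [show i + 1 - (a + 1) = i - a by omega]
          split_ifs at h1 ⊢ <;> omega

theorem length_blockPerm (c : List ℕ) : (blockPerm c).length = c.sum := by simp [blockPerm]

theorem getD_blockPerm {c : List ℕ} {i : ℕ} (hi : i < c.sum) :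
    (blockPerm c).getD i 0 = blockFun c i + 1 := by
  simp [blockPerm, hi]

theorem isPermList_iff_s11 {l : List ℕ} :
    IsPermList l ↔ l.Nodup ∧ ∀ v, v ∈ l ↔ 1 ≤ v ∧ v ≤ l.length := by
  have hnd : ((List.range l.length).map (· + 1)).Nodup :=
    List.nodup_range.map fun a b h => by simpa using h
  have hmem : ∀ v, v ∈ (List.range l.length).map (· + 1) ↔ 1 ≤ v ∧ v ≤ l.length := by
    intro v
    simp only [List.mem_map, List.mem_range]
    exact ⟨by rintro ⟨a, ha, rfl⟩; omega, fun h => ⟨v - 1, by omega, by omega⟩⟩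
  constructor
  · intro h
    exact ⟨h.nodup_iff.2 hnd, fun v => by rw [h.mem_iff, hmem]⟩
  · rintro ⟨h1, h2⟩
    exact (List.perm_ext_iff_of_nodup h1 hnd).2 fun v => by rw [h2, hmem]

theorem isPermList_blockPerm (c : List ℕ) : IsPermList (blockPerm c) := by
  rw [isPermList_iff_s11, length_blockPerm]
  refine ⟨List.nodup_range.map fun a b h => blockFun_inj (by simpa using h), fun v => ?_⟩
  simp only [blockPerm, List.mem_map, List.mem_range]
  constructor
  · rintro ⟨p, hp, rfl⟩
    have := blockFun_lt hp
    omega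
  · rintro ⟨h1, h2⟩
    obtain ⟨p, hp, h⟩ := @exists_blockFun_eq c (v - 1) (by omega)
    exact ⟨p, hp, by omega⟩

theorem involves_iff {σ τ : List ℕ} :
    Involves σ τ ↔ ∃ g : ℕ → ℕ, (∀ i j, i < j → j < σ.length → g i < g j) ∧
      (∀ i < σ.length, g i < τ.length) ∧
      ∀ i < σ.length, ∀ j < σ.length,
        (σ.getD i 0 < σ.getD j 0 ↔ τ.getD (g i) 0 < τ.getD (g j) 0) := by
  constructor
  · rintro ⟨f, hf, h⟩
    refine ⟨fun i => if hi : i < σ.length then f ⟨i, hi⟩ else 0, ?_, ?_, ?_⟩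
    · intro i j hij hj
      have := @hf ⟨i, hij.trans hj⟩ ⟨j, hj⟩ hij
      simpa [hij.trans hj, hj] using this
    · intro i hi
      simp [hi]
    · intro i hi j hj
      simpa [hi, hj] using h ⟨i, hi⟩ ⟨j, hj⟩
  · rintro ⟨g, hmono, hlt, h⟩
    refine ⟨fun i => ⟨g i, hlt i i.2⟩, fun i j hij => hmono i j hij j.2, fun i j => ?_⟩
    have hi := hlt i i.2
    have hj := hlt j j.2
    simpa [hi, hj] using h i i.2 j j.2

theorem involves_of_lt_pairs {σ τ : List ℕ} (g : ℕ → ℕ)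
    (h : ∀ i j, i < j → j < σ.length → g i < g j ∧ g j < τ.length ∧
      (σ.getD i 0 < σ.getD j 0 ∧ τ.getD (g i) 0 < τ.getD (g j) 0 ∨
        σ.getD j 0 < σ.getD i 0 ∧ τ.getD (g j) 0 < τ.getD (g i) 0))
    (h2 : 2 ≤ σ.length) : Involves σ τ := by
  refine involves_iff.2 ⟨g, fun i j hij hj => (h i j hij hj).1, fun i hi => ?_,
    fun i hi j hj => ?_⟩
  · obtain hi0 | hi0 := Nat.eq_zero_or_pos i
    · have := h 0 1 (by omega) (by omega)
      subst hi0
      omega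
    · exact (h 0 i hi0 hi).2.1
  · obtain hij | rfl | hij := lt_trichotomy i j
    · have := h i j hij hj
      omega
    · simp
    · have := h j i hij hi
      omega

theorem atMostOneSmaller_iff {l : List ℕ} (hl : l.Nodup) :
    AtMostOneSmaller (l.getD · 0) l.length ↔
      ¬ Involves [3, 1, 2] l ∧ ¬ Involves [3, 2, 1] l := by
  constructor
  · intro h
    constructor <;> rw [involves_iff] <;> rintro ⟨g, hg, hlt, hiff⟩ <;>
    · have h1 := hg 0 1 (by simp) (by simp)
      have h2 := hg 1 2 (by simp) (by simp)
      have h3 := hlt 2 (by simp)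
      have h4 := hiff 1 (by simp) 0 (by simp)
      have h5 := hiff 2 (by simp) 0 (by simp)
      have h6 := h _ _ _ h1 h2 h3
      simp only [List.getD_cons_zero, List.getD_cons_succ] at h4 h5 h6
      omega
  · rintro ⟨h312, h321⟩ i j m hij hjm hm hji
    by_contra! hmi
    dsimp only at hji hmi
    have hne : l.getD j 0 ≠ l.getD m 0 := by
      rw [List.getD_eq_getElem _ _ (hjm.trans hm), List.getD_eq_getElem _ _ hm]
      intro h
      have := (hl.getElem_inj_iff).1 h
      omega
    obtain h | h := lt_or_gt_of_ne hne
    · refine h312 (involves_of_lt_pairs (fun t => if t = 0 then i else if t = 1 then j else m)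
        (fun s t hst ht => ?_) (by simp))
      obtain ⟨rfl, rfl⟩ | ⟨rfl, rfl⟩ | ⟨rfl, rfl⟩ :
          s = 0 ∧ t = 1 ∨ s = 0 ∧ t = 2 ∨ s = 1 ∧ t = 2 := by
        simp only [List.length_cons, List.length_nil] at ht; omega
      all_goals simp; simp at hji hmi h; omega
    · refine h321 (involves_of_lt_pairs (fun t => if t = 0 then i else if t = 1 then j else m)
        (fun s t hst ht => ?_) (by simp))
      obtain ⟨rfl, rfl⟩ | ⟨rfl, rfl⟩ | ⟨rfl, rfl⟩ :
          s = 0 ∧ t = 1 ∨ s = 0 ∧ t = 2 ∨ s = 1 ∧ t = 2 := by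
        simp only [List.length_cons, List.length_nil] at ht; omega
      all_goals simp; simp at hji hmi h; omega

theorem atMostOneSmaller_blockPerm (c : List ℕ) :
    AtMostOneSmaller ((blockPerm c).getD · 0) (blockPerm c).length := by
  rw [length_blockPerm]
  intro i j m hij hjm hm h
  have := atMostOneSmaller_blockFun c i j m hij hjm hm
  dsimp only at h ⊢
  rw [getD_blockPerm (by omega), getD_blockPerm (by omega)] at h ⊢
  omega

theorem exists_blockPerm_eq {l : List ℕ} (hl : IsPermList l)
    (h : AtMostOneSmaller (l.getD · 0) l.length) :
    ∃ c : List ℕ, (∀ x ∈ c, 0 < x) ∧ blockPerm c = l := by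
  obtain ⟨hnd, hmem⟩ := isPermList_iff_s11.1 hl
  have hrange : ∀ i < l.length, 1 ≤ l.getD i 0 ∧ l.getD i 0 ≤ l.length := fun i hi => by
    rw [List.getD_eq_getElem _ _ hi]
    exact (hmem _).1 (List.getElem_mem hi)
  obtain ⟨c, hc, hsum, heq⟩ := @exists_blockFun_of_atMostOneSmaller l.length
    (fun i => l.getD i 0 - 1)
    (fun i hi => by have := hrange i hi; omega)
    (fun i hi j hj hij => by
      have h1 := hrange i hi
      have h2 := hrange j hj
      have h3 : l.getD i 0 = l.getD j 0 := by omega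
      rw [List.getD_eq_getElem _ _ hi, List.getD_eq_getElem _ _ hj] at h3
      exact hnd.getElem_inj_iff.1 h3)
    (fun v hv => by
      obtain ⟨i, hi, hiv⟩ := List.mem_iff_getElem.1 ((hmem (v + 1)).2 (by omega))
      exact ⟨i, hi, by simp [hi, hiv]⟩)
    (fun i j m hij hjm hm hji => by
      have h1 := hrange i (by omega)
      have h2 := hrange j (by omega)
      have h3 := hrange m (by omega)
      have h4 := h i j m hij hjm hm
      dsimp only at h4 hji ⊢
      omega)
  refine ⟨c, hc, List.ext_getElem (by rw [length_blockPerm, hsum]) fun i h1 h2 => ?_⟩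
  have h3 := heq i h2
  have h4 := hrange i h2
  have h5 := @getD_blockPerm c i (by omega)
  rw [List.getD_eq_getElem _ _ h1] at h5
  rw [List.getD_eq_getElem _ _ h2] at h3 h4
  omega

/-- Permutations avoiding 312, 321 and a pattern `σ` correspond to compositions. -/
theorem card_avoiding_eq_card_compositions (σ : List ℕ) (Q : List ℕ → Prop)
    (hQ : ∀ c : List ℕ, (∀ x ∈ c, 0 < x) → (¬ Involves σ (blockPerm c) ↔ Q c)) (n : ℕ) :
    Nat.card {l : List ℕ // l.length = n ∧ IsPermList l ∧
        ¬ Involves [3, 1, 2] l ∧ ¬ Involves [3, 2, 1] l ∧ ¬ Involves σ l} =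
      Nat.card {c : List ℕ // (∀ x ∈ c, 0 < x) ∧ c.sum = n ∧ Q c} := by
  symm
  refine Nat.card_congr (Equiv.ofBijective (fun c => ⟨blockPerm c.1, ?_⟩) ⟨?_, ?_⟩)
  · obtain ⟨h1, h2⟩ := (atMostOneSmaller_iff (isPermList_iff_s11.1 (isPermList_blockPerm c.1)).1).1
      (atMostOneSmaller_blockPerm c.1)
    exact ⟨by rw [length_blockPerm, c.2.2.1], isPermList_blockPerm _, h1, h2,
      (hQ _ c.2.1).2 c.2.2.2⟩
  · rintro ⟨c, hc, hcn, _⟩ ⟨d, hd, hdn, _⟩ h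
    have h : blockPerm c = blockPerm d := congrArg Subtype.val h
    refine Subtype.ext (eq_of_blockFun_eq hc hd (hcn.trans hdn.symm) fun p hp => ?_)
    change p < c.sum at hp
    change blockFun c p = blockFun d p
    have := getD_blockPerm hp
    rw [h, getD_blockPerm (by omega)] at this
    omega
  · rintro ⟨l, hn, hl, h1, h2, h3⟩
    obtain ⟨c, hc, rfl⟩ := exists_blockPerm_eq hl
      ((atMostOneSmaller_iff (isPermList_iff_s11.1 hl).1).2 ⟨h1, h2⟩)
    exact ⟨⟨c, hc, by rw [← hn, length_blockPerm], (hQ c hc).1 h3⟩, rfl⟩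

theorem length_beta {k : ℕ} (hk : 1 ≤ k) : (beta k).length = k := by
  simp [beta]; omega

theorem getD_beta {k t : ℕ} (ht : t < k) :
    (beta k).getD t 0 = if t + 1 = k then 1 else t + 2 := by
  split_ifs with h
  · subst h
    simp [beta]
  · rw [beta, List.getD_append _ _ _ _ (by simp; omega)]
    simp [show t < k - 1 by omega]

theorem length_dsum (σ τ : List ℕ) : (dsum σ τ).length = σ.length + τ.length := by
  simp [dsum]

theorem getD_dsum {σ τ : List ℕ} {t : ℕ} (ht : t < σ.length + τ.length) :
    (dsum σ τ).getD t 0 =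
      if t < σ.length then σ.getD t 0 else τ.getD (t - σ.length) 0 + σ.length := by
  split_ifs with h
  · rw [dsum, List.getD_append _ _ _ _ h]
  · rw [dsum, List.getD_append_right _ _ _ _ (by omega)]
    simp [show t - σ.length < τ.length by omega]

theorem getD_dsum_two_one_beta {k t : ℕ} (ht : t < k + 2) :
    (dsum [2, 1] (beta k)).getD t 0 =
      if t = 0 then 2 else if t = 1 then 1 else if t = k + 1 then 3 else t + 2 := by
  obtain rfl | hk := Nat.eq_zero_or_pos k
  · interval_cases t <;> simp [dsum]
  rw [getD_dsum (by rw [length_beta hk]; simp; omega)]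
  obtain _ | _ | t := t
  · simp
  · simp
  · simp [-List.getD_eq_getElem?_getD, getD_beta (show t < k by omega)]
    split_ifs <;> omega

theorem getD_dsum_one_beta_one {k t : ℕ} (hk : 1 ≤ k) (ht : t < k + 2) :
    (dsum (dsum [1] (beta k)) [1]).getD t 0 =
      if t = 0 then 1 else if t = k then 2 else t + if t = k + 1 then 1 else 2 := by
  have h1 : (dsum [1] (beta k)).length = k + 1 := by
    rw [length_dsum, length_beta hk, List.length_singleton, add_comm]
  rw [getD_dsum (by rw [h1]; exact ht), h1]
  obtain rfl | htk := eq_or_ne t (k + 1)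
  · simp
    omega
  rw [if_pos (by omega), getD_dsum (by rw [length_beta hk]; simp; omega)]
  obtain _ | t := t
  · simp
  · simp [-List.getD_eq_getElem?_getD, getD_beta (show t < k by omega)]
    split_ifs <;> omega

theorem add_le_of_strictMono_below {g : ℕ → ℕ} {n : ℕ} (hg : ∀ i j, i < j → j < n → g i < g j)
    (s : ℕ) : ∀ t, s + t < n → g s + t ≤ g (s + t)
  | 0, _ => by simp
  | t + 1, h => by
    have h1 := add_le_of_strictMono_below hg s t (by omega)
    have h2 := hg (s + t) (s + t + 1) (by omega) h
    rw [← add_assoc, ← add_assoc]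
    omega

theorem blockFun_lt_of_inversion {c : List ℕ} {p q r : ℕ} (hpq : p < q) (hqr : q < r)
    (hr : r < c.sum) (h : blockFun c q < blockFun c p) : blockFun c p < blockFun c r := by
  have h1 := atMostOneSmaller_blockFun c p q r hpq hqr hr h
  have h2 := @blockFun_inj c p r
  omega

theorem le_blockFun_of_inversion {c : List ℕ} {p q r : ℕ} (hpr : p ≤ r) (hrq : r < q)
    (hq : q < c.sum) (h : blockFun c q < blockFun c p) :
    blockFun c p ≤ blockFun c r := by
  obtain rfl | hpr := hpr.eq_or_lt
  · rfl
  have h1 := atMostOneSmaller_blockFun c p r q hpr hrq hq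
  omega

theorem blockFun_strictMono_of_inversion {c : List ℕ} {p q r s : ℕ} (hpr : p ≤ r) (hrs : r < s)
    (hsq : s < q) (hq : q < c.sum) (h : blockFun c q < blockFun c p) :
    blockFun c r < blockFun c s := by
  have h1 := le_blockFun_of_inversion hpr (hrs.trans hsq) hq h
  have h2 := atMostOneSmaller_blockFun c r s q hrs hsq hq
  have h3 := @blockFun_inj c r s
  omega

theorem involves_two_one_beta_iff {k : ℕ} (hk : 2 ≤ k) (c : List ℕ) :
    Involves (dsum [2, 1] (beta k)) (blockPerm c) ↔
      ∃ i j p q, i < j ∧ j < p ∧ p + k ≤ q + 1 ∧ q < c.sum ∧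
        blockFun c j < blockFun c i ∧ blockFun c q < blockFun c p := by
  have hlen : (dsum [2, 1] (beta k)).length = k + 2 := by
    rw [length_dsum, length_beta (by omega)]; simp [add_comm]
  constructor
  · rw [involves_iff, hlen, length_blockPerm]
    rintro ⟨g, hg, hlt, hiff⟩
    refine ⟨g 0, g 1, g 2, g (k + 1), hg _ _ (by omega) (by omega), hg _ _ (by omega) (by omega),
      ?_, hlt _ (by omega), ?_, ?_⟩
    · have := add_le_of_strictMono_below hg 2 (k - 1) (by omega)
      rw [show 2 + (k - 1) = k + 1 by omega] at this
      omega
    · have := hiff 1 (by omega) 0 (by omega)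
      rw [getD_dsum_two_one_beta (by omega), getD_dsum_two_one_beta (by omega),
        getD_blockPerm (hlt _ (by omega)), getD_blockPerm (hlt _ (by omega))] at this
      simpa using this
    · have := hiff (k + 1) (by omega) 2 (by omega)
      rw [getD_dsum_two_one_beta (by omega), getD_dsum_two_one_beta (by omega),
        getD_blockPerm (hlt _ (by omega)), getD_blockPerm (hlt _ (by omega))] at this
      simpa [show k ≠ 0 by omega, show k ≠ 1 by omega, show 2 ≠ k + 1 by omega] using this
  · rintro ⟨i, j, p, q, hij, hjp, hpq, hq, hji, hqp⟩
    refine involves_of_lt_pairs (fun t => if t = 0 then i else if t = 1 then j else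
      if t = k + 1 then q else p + t - 2) (fun s t hst ht => ?_) (by omega)
    rw [hlen] at ht
    rw [getD_dsum_two_one_beta (by omega), getD_dsum_two_one_beta (by omega), length_blockPerm]
    have hbig : ∀ r, j < r → r < c.sum → blockFun c i < blockFun c r :=
      fun r h1 h2 => blockFun_lt_of_inversion hij h1 h2 hji
    have hq' := hbig q (by omega) hq
    have hs := hbig (p + s - 2)
    have ht' := hbig (p + t - 2)
    have hmid := @le_blockFun_of_inversion c p q (p + s - 2)
    have hmono := @blockFun_strictMono_of_inversion c p q (p + s - 2) (p + t - 2)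
    refine ⟨by split_ifs <;> omega, by split_ifs <;> omega, ?_⟩
    rw [getD_blockPerm (by split_ifs <;> omega), getD_blockPerm (by split_ifs <;> omega)]
    split_ifs <;> omega

theorem involves_one_beta_one_iff {k : ℕ} (hk : 2 ≤ k) (c : List ℕ) :
    Involves (dsum (dsum [1] (beta k)) [1]) (blockPerm c) ↔
      ∃ i p q j, i < p ∧ p + k ≤ q + 1 ∧ q < j ∧ j < c.sum ∧
        blockFun c i < blockFun c q ∧ blockFun c q < blockFun c p := by
  have hlen : (dsum (dsum [1] (beta k)) [1]).length = k + 2 := by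
    rw [length_dsum, length_dsum, length_beta (by omega)]; simp; omega
  constructor
  · rw [involves_iff, hlen, length_blockPerm]
    rintro ⟨g, hg, hlt, hiff⟩
    refine ⟨g 0, g 1, g k, g (k + 1), hg _ _ (by omega) (by omega),
      ?_, hg _ _ (by omega) (by omega), hlt _ (by omega), ?_, ?_⟩
    · have := add_le_of_strictMono_below hg 1 (k - 1) (by omega)
      rw [show 1 + (k - 1) = k by omega] at this
      omega
    · have := hiff 0 (by omega) k (by omega)
      rw [getD_dsum_one_beta_one (by omega) (by omega),
        getD_dsum_one_beta_one (by omega) (by omega),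
        getD_blockPerm (hlt _ (by omega)), getD_blockPerm (hlt _ (by omega))] at this
      simpa [show k ≠ 0 by omega] using this
    · have := hiff k (by omega) 1 (by omega)
      rw [getD_dsum_one_beta_one (by omega) (by omega),
        getD_dsum_one_beta_one (by omega) (by omega),
        getD_blockPerm (hlt _ (by omega)), getD_blockPerm (hlt _ (by omega))] at this
      simpa [show k ≠ 0 by omega, show 1 ≠ k by omega] using this
  · rintro ⟨i, p, q, j, hip, hpq, hqj, hj, hiq, hqp⟩
    refine involves_of_lt_pairs (fun t => if t = 0 then i else if t = k then q else
      if t = k + 1 then j else p + t - 1) (fun s t hst ht => ?_) (by omega)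
    rw [hlen] at ht
    rw [getD_dsum_one_beta_one (by omega) (by omega),
      getD_dsum_one_beta_one (by omega) (by omega), length_blockPerm]
    have hmid : ∀ r, p ≤ r → r < q → blockFun c p ≤ blockFun c r :=
      fun r h1 h2 => le_blockFun_of_inversion h1 h2 (by omega) hqp
    have hpj := blockFun_lt_of_inversion (by omega) hqj hj hqp
    have hms := hmid (p + s - 1)
    have hmt := hmid (p + t - 1)
    have hsj := @blockFun_lt_of_inversion c (p + s - 1) q j
    have hmono := @blockFun_strictMono_of_inversion c p q (p + s - 1) (p + t - 1)
    refine ⟨by split_ifs <;> omega, by split_ifs <;> omega, ?_⟩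
    rw [getD_blockPerm (by split_ifs <;> omega), getD_blockPerm (by split_ifs <;> omega)]
    split_ifs <;> omega

theorem exists_inversion_iff {k : ℕ} (hk : 2 ≤ k) (c : List ℕ) :
    (∃ p q, p + k ≤ q + 1 ∧ q < c.sum ∧ blockFun c q < blockFun c p) ↔ ∃ x ∈ c, k ≤ x := by
  induction c with
  | nil => simp
  | cons a c ih =>
    rw [List.exists_mem_cons_iff, ← ih, List.sum_cons]
    constructor
    · rintro ⟨p, q, hpq, hq, h⟩
      by_cases hpa : a ≤ p
      · obtain ⟨p, rfl⟩ := Nat.exists_eq_add_of_le hpa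
        obtain ⟨q, rfl⟩ := Nat.exists_eq_add_of_le (show a ≤ q by omega)
        rw [blockFun_cons_add, blockFun_cons_add] at h
        exact .inr ⟨p, q, by omega, by omega, by omega⟩
      · left
        simp only [blockFun] at h
        split_ifs at h <;> omega
    · rintro (h | ⟨p, q, hpq, hq, h⟩)
      · refine ⟨0, a - 1, by omega, by omega, ?_⟩
        simp only [blockFun]
        split_ifs <;> omega
      · refine ⟨a + p, a + q, by omega, by omega, ?_⟩
        rw [blockFun_cons_add, blockFun_cons_add]
        omega

theorem exists_two_inversions_iff {k : ℕ} (hk : 2 ≤ k) (c : List ℕ) :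
    (∃ i j p q, i < j ∧ j < p ∧ p + k ≤ q + 1 ∧ q < c.sum ∧
        blockFun c j < blockFun c i ∧ blockFun c q < blockFun c p) ↔
      ¬ c.Pairwise fun x y => 2 ≤ x → y < k := by
  induction c with
  | nil => simp
  | cons a c ih =>
    rw [List.pairwise_cons, not_and_or, ← ih, List.sum_cons]
    have hinv : (¬ ∀ y ∈ c, 2 ≤ a → y < k) ↔ 2 ≤ a ∧ ∃ x ∈ c, k ≤ x := by
      push Not
      exact ⟨fun ⟨x, h1, h2, h3⟩ => ⟨h2, x, h1, h3⟩, fun ⟨h2, x, h1, h3⟩ => ⟨x, h1, h2, h3⟩⟩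
    rw [hinv, ← exists_inversion_iff hk]
    constructor
    · rintro ⟨i, j, p, q, hij, hjp, hpq, hq, hji, hqp⟩
      have hap : a ≤ p := by
        by_contra hap
        simp only [blockFun] at hji
        split_ifs at hji <;> omega
      obtain ⟨p, rfl⟩ := Nat.exists_eq_add_of_le hap
      obtain ⟨q, rfl⟩ := Nat.exists_eq_add_of_le (show a ≤ q by omega)
      rw [blockFun_cons_add, blockFun_cons_add] at hqp
      by_cases hai : a ≤ i
      · obtain ⟨i, rfl⟩ := Nat.exists_eq_add_of_le hai
        obtain ⟨j, rfl⟩ := Nat.exists_eq_add_of_le (show a ≤ j by omega)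
        rw [blockFun_cons_add, blockFun_cons_add] at hji
        exact .inr ⟨i, j, p, q, by omega, by omega, by omega, by omega, by omega, by omega⟩
      · refine .inl ⟨?_, p, q, by omega, by omega, by omega⟩
        simp only [blockFun] at hji
        split_ifs at hji <;> omega
    · rintro (⟨ha, p, q, hpq, hq, h⟩ | ⟨i, j, p, q, hij, hjp, hpq, hq, hji, hqp⟩)
      · refine ⟨0, a - 1, a + p, a + q, by omega, by omega, by omega, by omega, ?_, ?_⟩
        · simp only [blockFun]
          split_ifs <;> omega
        · rw [blockFun_cons_add, blockFun_cons_add]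
          omega
      · refine ⟨a + i, a + j, a + p, a + q, by omega, by omega, by omega, by omega, ?_, ?_⟩ <;>
        · rw [blockFun_cons_add, blockFun_cons_add]
          omega

theorem exists_nonfinal_inversion_iff {k : ℕ} (hk : 2 ≤ k) {c : List ℕ} (hc : ∀ x ∈ c, 0 < x) :
    (∃ p q j, p + k ≤ q + 1 ∧ q < j ∧ j < c.sum ∧ blockFun c q < blockFun c p) ↔
      ∃ x ∈ c.dropLast, k ≤ x := by
  induction c with
  | nil => simp
  | cons a c ih =>
    obtain rfl | ⟨b, d, rfl⟩ : c = [] ∨ ∃ b d, c = b :: d := by cases c <;> simp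
    · simp only [List.dropLast_singleton, List.not_mem_nil, false_and, exists_false, iff_false]
      rintro ⟨p, q, j, hpq, hqj, hj, h⟩
      simp only [blockFun, List.sum_singleton] at h hj
      split_ifs at h <;> omega
    rw [List.dropLast_cons_of_ne_nil (by simp), List.exists_mem_cons_iff,
      ← ih fun x hx => hc x (by simp [hx]), List.sum_cons]
    constructor
    · rintro ⟨p, q, j, hpq, hqj, hj, h⟩
      by_cases hpa : a ≤ p
      · obtain ⟨p, rfl⟩ := Nat.exists_eq_add_of_le hpa
        obtain ⟨q, rfl⟩ := Nat.exists_eq_add_of_le (show a ≤ q by omega)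
        rw [blockFun_cons_add, blockFun_cons_add] at h
        exact .inr ⟨p, q, j - a, by omega, by omega, by omega, by omega⟩
      · left
        simp only [blockFun] at h
        split_ifs at h <;> omega
    · rintro (h | ⟨p, q, j, hpq, hqj, hj, h⟩)
      · have hb := hc b (by simp)
        refine ⟨0, a - 1, a, by omega, by omega, by simp; omega, ?_⟩
        simp only [blockFun]
        split_ifs <;> omega
      · refine ⟨a + p, a + q, a + j, by omega, by omega, by omega, ?_⟩
        rw [blockFun_cons_add, blockFun_cons_add]
        omega

theorem exists_interior_inversion_iff {k : ℕ} (hk : 2 ≤ k) {c : List ℕ} (hc : ∀ x ∈ c, 0 < x) :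
    (∃ i p q j, i < p ∧ p + k ≤ q + 1 ∧ q < j ∧ j < c.sum ∧
        blockFun c i < blockFun c q ∧ blockFun c q < blockFun c p) ↔
      ∃ x ∈ c.tail.dropLast, k ≤ x := by
  obtain _ | ⟨a, c⟩ := c
  · simp
  have ha := hc a (by simp)
  rw [List.tail_cons, ← exists_nonfinal_inversion_iff hk fun x hx => hc x (by simp [hx]),
    List.sum_cons]
  constructor
  · rintro ⟨i, p, q, j, hip, hpq, hqj, hj, hiq, hqp⟩
    have hap : a ≤ p := by
      by_contra hap
      simp only [blockFun] at hiq hqp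
      split_ifs at hiq hqp <;> omega
    obtain ⟨p, rfl⟩ := Nat.exists_eq_add_of_le hap
    obtain ⟨q, rfl⟩ := Nat.exists_eq_add_of_le (show a ≤ q by omega)
    rw [blockFun_cons_add, blockFun_cons_add] at hqp
    exact ⟨p, q, j - a, by omega, by omega, by omega, by omega⟩
  · rintro ⟨p, q, j, hpq, hqj, hj, h⟩
    refine ⟨a - 1, a + p, a + q, a + j, by omega, by omega, by omega, by omega, ?_, ?_⟩
    · rw [blockFun_cons_add]
      simp only [blockFun]
      split_ifs <;> omega
    · rw [blockFun_cons_add, blockFun_cons_add]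
      omega

/-- `1^m ++ b :: d ↦ (m + 1) :: d ++ [b - 1]` for `b ≠ 1`, and `1^m ↦ [m]`. -/
def onesToHead (c : List ℕ) : List ℕ :=
  match c.dropWhile (· = 1) with
  | [] => if c = [] then [] else [c.length]
  | b :: d => (c.length - d.length) :: (d ++ [b - 1])

/-- `x :: d ++ [y] ↦ 1^(x - 1) ++ (y + 1) :: d`, and `[x] ↦ 1^x`. -/
def headToOnes : List ℕ → List ℕ
  | [] => []
  | [x] => List.replicate x 1
  | x :: y :: t => List.replicate (x - 1) 1 ++ ((y :: t).getLast (by simp) + 1) :: (y :: t).dropLast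

theorem headToOnes_cons_append_singleton (x : ℕ) (d : List ℕ) (y : ℕ) :
    headToOnes (x :: (d ++ [y])) = List.replicate (x - 1) 1 ++ (y + 1) :: d := by
  obtain _ | ⟨z, d⟩ := d
  · simp [headToOnes]
  · simp [headToOnes, List.dropLast_cons_of_ne_nil]

theorem onesToHead_replicate (m : ℕ) (hm : 0 < m) :
    onesToHead (List.replicate m 1) = [m] := by
  simp [onesToHead, hm.ne']

theorem onesToHead_replicate_append (m b : ℕ) (d : List ℕ) (hb : b ≠ 1) :
    onesToHead (List.replicate m 1 ++ b :: d) = (m + 1) :: (d ++ [b - 1]) := by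
  have : (List.replicate m 1 ++ b :: d).dropWhile (· = 1) = b :: d := by
    rw [List.dropWhile_append_of_pos (by simp), List.dropWhile_cons_of_neg (by simpa)]
  rw [onesToHead, this]
  simp
  omega

theorem eq_replicate_or_eq_replicate_append (c : List ℕ) :
    (∃ m, c = List.replicate m 1) ∨ ∃ m b d, b ≠ 1 ∧ c = List.replicate m 1 ++ b :: d := by
  induction c with
  | nil => exact .inl ⟨0, rfl⟩
  | cons a c ih =>
    obtain rfl | ha := eq_or_ne a 1
    · obtain ⟨m, rfl⟩ | ⟨m, b, d, hb, rfl⟩ := ih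
      · exact .inl ⟨m + 1, rfl⟩
      · exact .inr ⟨m + 1, b, d, hb, rfl⟩
    · exact .inr ⟨0, a, c, ha, rfl⟩

theorem eq_nil_or_singleton_or_cons_append_singleton (c : List ℕ) :
    c = [] ∨ (∃ x, c = [x]) ∨ ∃ x d y, c = x :: (d ++ [y]) := by
  obtain _ | ⟨x, c⟩ := c
  · simp
  · obtain rfl | ⟨d, y, rfl⟩ := c.eq_nil_or_concat'
    · simp
    · exact .inr (.inr ⟨x, d, y, rfl⟩)

theorem card_compositions_eq (k n : ℕ) :
    Nat.card {c : List ℕ // (∀ x ∈ c, 0 < x) ∧ c.sum = n ∧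
        c.Pairwise fun x y => 2 ≤ x → y < k} =
      Nat.card {c : List ℕ // (∀ x ∈ c, 0 < x) ∧ c.sum = n ∧
        ∀ x ∈ c.tail.dropLast, x < k} := by
  refine Nat.card_congr ⟨fun c => ⟨onesToHead c.1, ?_⟩, fun c => ⟨headToOnes c.1, ?_⟩, ?_, ?_⟩
  · obtain ⟨c, hpos, hsum, hp⟩ := c
    obtain ⟨m, rfl⟩ | ⟨m, b, d, hb, rfl⟩ := eq_replicate_or_eq_replicate_append c
    · obtain rfl | hm := Nat.eq_zero_or_pos m
      · simpa [onesToHead] using hsum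
      · rw [onesToHead_replicate m hm]
        simpa [hm] using hsum
    · have hb0 := hpos b (by simp)
      rw [onesToHead_replicate_append m b d hb]
      rw [List.pairwise_append, List.pairwise_cons] at hp
      refine ⟨fun x hx => ?_, ?_, ?_⟩
      · simp only [List.mem_cons, List.mem_append, List.not_mem_nil, or_false] at hx
        obtain rfl | hx | rfl := hx
        · omega
        · exact hpos x (by simp [hx])
        · omega
      · simp at hsum ⊢
        omega
      · simpa using fun x hx => hp.2.1.1 x hx (by omega)
  · obtain ⟨c, hpos, hsum, hp⟩ := c
    obtain rfl | ⟨x, rfl⟩ | ⟨x, d, y, rfl⟩ := eq_nil_or_singleton_or_cons_append_singleton c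
    · simpa [headToOnes] using hsum
    · simp only [headToOnes]
      refine ⟨fun z hz => by simp [List.eq_of_mem_replicate hz], by simpa using hsum, ?_⟩
      simp [List.pairwise_replicate]
    · have hx := hpos x (by simp)
      have hd : ∀ z ∈ d, z < k := by simpa using hp
      rw [headToOnes_cons_append_singleton]
      refine ⟨fun z hz => ?_, ?_, ?_⟩
      · simp only [List.mem_append, List.mem_cons] at hz
        obtain hz | rfl | hz := hz
        · simp [List.eq_of_mem_replicate hz]
        · omega
        · exact hpos z (by simp [hz])
      · simp at hsum ⊢
        omega
      · rw [List.pairwise_append, List.pairwise_cons]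
        refine ⟨by simp [List.pairwise_replicate], ⟨fun z hz _ => hd z hz, ?_⟩, ?_⟩
        · exact List.pairwise_of_forall_mem_list fun z _ w hw _ => hd w hw
        · intro z hz w _ h
          rw [List.eq_of_mem_replicate hz] at h
          omega
  · rintro ⟨c, hpos, -, -⟩
    refine Subtype.ext ?_
    dsimp only
    obtain ⟨m, rfl⟩ | ⟨m, b, d, hb, rfl⟩ := eq_replicate_or_eq_replicate_append c
    · obtain rfl | hm := Nat.eq_zero_or_pos m
      · simp [onesToHead, headToOnes]
      · rw [onesToHead_replicate m hm, headToOnes]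
    · have hb0 := hpos b (by simp)
      rw [onesToHead_replicate_append m b d hb, headToOnes_cons_append_singleton,
        Nat.add_sub_cancel, Nat.sub_add_cancel hb0]
  · rintro ⟨c, hpos, -, -⟩
    refine Subtype.ext ?_
    dsimp only
    obtain rfl | ⟨x, rfl⟩ | ⟨x, d, y, rfl⟩ := eq_nil_or_singleton_or_cons_append_singleton c
    · simp [onesToHead, headToOnes]
    · rw [headToOnes, onesToHead_replicate x (hpos x (by simp))]
    · have hx := hpos x (by simp)
      have hy := hpos y (by simp)
      rw [headToOnes_cons_append_singleton, onesToHead_replicate_append _ _ _ (by omega),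
        Nat.add_sub_cancel, Nat.sub_add_cancel hx]

/-- `Av(312, 321, 21 ⊕ β_k)` and `Av(312, 321, 1 ⊕ β_k ⊕ 1)` are Wilf-equivalent. -/
theorem av312_321_trade (k : ℕ) (hk : 2 ≤ k) (n : ℕ) :
    Nat.card {l : List ℕ // l.length = n ∧ IsPermList l ∧
        ¬ Involves [3, 1, 2] l ∧ ¬ Involves [3, 2, 1] l ∧
        ¬ Involves (dsum [2, 1] (beta k)) l} =
    Nat.card {l : List ℕ // l.length = n ∧ IsPermList l ∧
        ¬ Involves [3, 1, 2] l ∧ ¬ Involves [3, 2, 1] l ∧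
        ¬ Involves (dsum (dsum [1] (beta k)) [1]) l} := by
  rw [card_avoiding_eq_card_compositions _ _ (fun c _ => by
      rw [involves_two_one_beta_iff hk, exists_two_inversions_iff hk, not_not]),
    card_avoiding_eq_card_compositions _ (fun c => ∀ x ∈ c.tail.dropLast, x < k) (fun c hc => by
      rw [involves_one_beta_one_iff hk, exists_interior_inversion_iff hk hc]
      push Not
      rfl),
    card_compositions_eq]
end
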